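/- arXiv:1711.01972 — 9 statements merged into one kernel-verified Lean document; each statement's English description precedes it below -/
import Mathlib

section
/- Let C be a finite subset of a metric space with distance c, let v : C → ℝ_{≥0} be any function, and let T ≥ 0. Then there exists a subset C' ⊆ C such that: (i) for all distinct j, j' ∈ C' one has c(j,j') > 4·max(v(j), v(j')) + 4T; and (ii) for every j ∈ C ∖ C' there exists j' ∈ C' with v(j') ≤ v(j) and c(j,j') ≤ 4·v(j) + 4T. -/
open Finset

theorem stmt2 {X : Type*} [MetricSpace X] (C : Finset X) (v : X → ℝ)
    (hv : ∀ j ∈ C, 0 ≤ v j) (T : ℝ) (hT : 0 ≤ T) :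
    ∃ C' ⊆ C,
      (∀ j ∈ C', ∀ j' ∈ C', j ≠ j' →
        4 * max (v j) (v j') + 4 * T < dist j j') ∧
      (∀ j ∈ C, j ∉ C' →
        ∃ j' ∈ C', v j' ≤ v j ∧ dist j j' ≤ 4 * v j + 4 * T) := by
  classical
  clear hv hT
  induction C using Finset.induction_on_max_value v with
  | empty => exact ⟨∅, by simp⟩
  | insert a s ha hmax ih =>
    obtain ⟨C', hsub, hsep, hcov⟩ := ih
    by_cases h : ∃ j' ∈ C', dist a j' ≤ 4 * v a + 4 * T
    · obtain ⟨k, hk, hak⟩ := h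
      refine ⟨C', hsub.trans (subset_insert a s), hsep, fun j hj hjC' => ?_⟩
      rcases mem_insert.mp hj with rfl | hj
      · exact ⟨k, hk, hmax k (hsub hk), hak⟩
      · exact hcov j hj hjC'
    · push Not at h
      refine ⟨insert a C', insert_subset_insert a hsub, fun j hj j' hj' hne => ?_,
        fun j hj hjC' => ?_⟩
      · rcases mem_insert.mp hj with rfl | hjC <;> rcases mem_insert.mp hj' with rfl | hjC'
        · exact absurd rfl hne
        · rw [max_eq_left (hmax j' (hsub hjC'))]
          exact h j' hjC'
        · rw [max_eq_right (hmax j (hsub hjC)), dist_comm]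
          exact h j hjC
        · exact hsep j hjC j' hjC' hne
      · rw [mem_insert, not_or] at hjC'
        obtain ⟨k, hk, hkj⟩ := hcov j (mem_of_mem_insert_of_ne hj hjC'.1) hjC'.2
        exact ⟨k, mem_insert_of_mem hk, hkj⟩
end

section
/- Let F (facilities) and C (clients) be finite subsets of a metric space with distance c, and let (x,y) be a normalized fractional solution to the k-median LP, with c_av(j) = Σ_{i∈F} x_{ij}·c(i,j). Let C' ⊆ C with |C'| ≥ 2 be such that for all distinct j, j' ∈ C' one has c(j,j') > 4·max(c_av(j), c_av(j')). For each j ∈ C' define R_j = (1/2)·min{c(j,j') : j' ∈ C', j' ≠ j} and the bundle U_j = {i ∈ F : c(i,j) < R_j and x_{ij} > 0}. Then: (i) Σ_{i∈U_j} y_i > 1/2 for every j ∈ C'; and (ii) U_j ∩ U_{j'} = ∅ for all distinct j, j' ∈ C'. -/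
open Finset

/-- Markov's inequality for a finite probability weight: if the mean of `d` is below `r / 2`,
then the support points with `d < r` carry more than half of the mass. -/
theorem half_lt_sum_of_two_mul_mean_lt {ι : Type*} {F U : Finset ι} {w d : ι → ℝ} {r : ℝ}
    (hw : ∀ i ∈ F, 0 ≤ w i) (hd : ∀ i ∈ F, 0 ≤ d i) (hsum : ∑ i ∈ F, w i = 1)
    (hr : 2 * ∑ i ∈ F, w i * d i < r)
    (hU : ∀ i, i ∈ U ↔ i ∈ F ∧ d i < r ∧ 0 < w i) :
    1 / 2 < ∑ i ∈ U, w i := by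
  classical
  have hUF : U ⊆ F := fun i hi => ((hU i).1 hi).1
  have hmean : 0 ≤ ∑ i ∈ F, w i * d i :=
    sum_nonneg fun i hi => mul_nonneg (hw i hi) (hd i hi)
  have htail : r * ∑ i ∈ F \ U, w i ≤ ∑ i ∈ F, w i * d i := by
    rw [mul_sum]
    refine le_trans (sum_le_sum fun i hi => ?_) (sum_le_sum_of_subset_of_nonneg sdiff_subset
      fun i hi _ => mul_nonneg (hw i hi) (hd i hi))
    obtain ⟨hiF, hiU⟩ := mem_sdiff.1 hi
    rcases (hw i hiF).eq_or_lt with h0 | hpos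
    · simp [← h0]
    · have hri : r ≤ d i := not_lt.1 fun h => hiU ((hU i).2 ⟨hiF, h, hpos⟩)
      rw [mul_comm]
      exact mul_le_mul_of_nonneg_left hri hpos.le
  have hsplit := sum_sdiff (f := w) hUF
  rw [hsum] at hsplit
  by_contra! hle
  have htail_half : 1 / 2 ≤ ∑ i ∈ F \ U, w i := by linarith
  have := mul_le_mul_of_nonneg_left htail_half (by linarith : 0 ≤ r)
  linarith

/-- The infimum of the distances from a point to the other points of a nontrivial finite set
is attained. -/
theorem isLeast_sInf_dist_ne {X : Type*} [MetricSpace X] {S : Finset X} (hS : 2 ≤ S.card)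
    (j : X) :
    IsLeast {d : ℝ | ∃ j' ∈ S, j' ≠ j ∧ d = dist j j'}
      (sInf {d : ℝ | ∃ j' ∈ S, j' ≠ j ∧ d = dist j j'}) := by
  have hfin : {d : ℝ | ∃ j' ∈ S, j' ≠ j ∧ d = dist j j'}.Finite := by
    refine (S.finite_toSet.image fun j' => dist j j').subset ?_
    rintro d ⟨j', hj', -, rfl⟩
    exact ⟨j', hj', rfl⟩
  obtain ⟨j', hj', hne⟩ := exists_mem_ne (by omega : 1 < S.card) j
  exact ⟨Set.Nonempty.csInf_mem ⟨_, j', hj', hne, rfl⟩ hfin,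
    fun d hd => csInf_le hfin.bddBelow hd⟩

theorem stmt3 {X : Type*} [MetricSpace X] (F C : Finset X) (k : ℕ)
    (x : X → X → ℝ) (y : X → ℝ)
    -- (x, y) is a feasible fractional solution of the k-median LP
    (hy : ∀ i ∈ F, 0 ≤ y i ∧ y i ≤ 1)
    (hx : ∀ i ∈ F, ∀ j ∈ C, 0 ≤ x i j ∧ x i j ≤ y i)
    (hxsum : ∀ j ∈ C, ∑ i ∈ F, x i j = 1)
    (hysum : ∑ i ∈ F, y i = (k : ℝ))
    -- normalized
    (hnorm : ∀ i ∈ F, ∀ j ∈ C, x i j = 0 ∨ x i j = y i)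
    -- the set of cluster centers, pairwise far apart relative to the
    -- average connection costs c_av
    (C' : Finset X) (hC'sub : C' ⊆ C) (hC'card : 2 ≤ C'.card)
    (hsep : ∀ j ∈ C', ∀ j' ∈ C', j ≠ j' →
      4 * max (∑ i ∈ F, x i j * dist i j) (∑ i ∈ F, x i j' * dist i j') < dist j j')
    -- the radii R_j
    (R : X → ℝ)
    (hR : ∀ j ∈ C', R j = (1 / 2) * sInf {d : ℝ | ∃ j' ∈ C', j' ≠ j ∧ d = dist j j'})
    -- the bundles U_j
    (U : X → Finset X)
    (hU : ∀ j ∈ C', ∀ i, i ∈ U j ↔ i ∈ F ∧ dist i j < R j ∧ 0 < x i j) :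
    (∀ j ∈ C', 1 / 2 < ∑ i ∈ U j, y i) ∧
    (∀ j ∈ C', ∀ j' ∈ C', j ≠ j' → Disjoint (U j) (U j')) := by
  refine ⟨fun j hj => ?_, fun j hj j' hj' hne => ?_⟩
  · have hjC := hC'sub hj
    have hvol : ∑ i ∈ U j, y i = ∑ i ∈ U j, x i j := by
      refine sum_congr rfl fun i hi => ?_
      obtain ⟨hiF, -, hpos⟩ := (hU j hj i).1 hi
      exact ((hnorm i hiF j hjC).resolve_left hpos.ne').symm
    obtain ⟨j', hj', hne, hmin⟩ := (isLeast_sInf_dist_ne hC'card j).1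
    rw [hvol]
    refine half_lt_sum_of_two_mul_mean_lt (fun i hi => (hx i hi j hjC).1)
      (fun i _ => dist_nonneg) (hxsum j hjC) ?_ (hU j hj)
    rw [hR j hj, hmin]
    have hfar := hsep j hj j' hj' hne.symm
    have hle := le_max_left (∑ i ∈ F, x i j * dist i j) (∑ i ∈ F, x i j' * dist i j')
    linarith
  · rw [disjoint_left]
    intro i hi hi'
    have hlt := ((hU j hj i).1 hi).2.1
    have hlt' := ((hU j' hj' i).1 hi').2.1
    have hle := (isLeast_sInf_dist_ne hC'card j).2 ⟨j', hj', hne.symm, rfl⟩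
    have hle' := (isLeast_sInf_dist_ne hC'card j').2 ⟨j, hj, hne, rfl⟩
    rw [hR j hj] at hlt
    rw [hR j' hj'] at hlt'
    rw [dist_comm j' j] at hle'
    have htri := dist_triangle_left j j' i
    linarith
end

section
/- Let F be a finite set, let k be a positive integer, and let y : F → [0,1] satisfy Σ_{i∈F} y_i = k. Let U_1, ..., U_m ⊆ F be pairwise disjoint sets with 1/2 ≤ vol(U_t) ≤ 1 for each t, where vol(U) = Σ_{i∈U} y_i, and let M be a set of pairwise disjoint (unordered) pairs of indices from {1,...,m}. Then there exists a finitely supported probability distribution μ over subsets S ⊆ F such that: (i) |S| ≤ k holds μ-almost surely; (ii) for every i ∈ F, the probability that i ∈ S equals y_i; (iii) for every t ∈ {1,...,m}, the probability that S ∩ U_t ≠ ∅ equals vol(U_t); and (iv) for every pair {t,t'} ∈ M, the probability that S ∩ (U_t ∪ U_{t'}) ≠ ∅ equals 1. -/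
open Finset

section LaminarRounding

variable {α : Type*}

/-- A real number is integral if it is the cast of an integer. -/
def IsIntegerCast (r : ℝ) : Prop := r ∈ (Int.castAddHom ℝ).range

lemma isIntegerCast_intCast (z : ℤ) : IsIntegerCast (z : ℝ) := ⟨z, rfl⟩

/-- On every set of `L`, the weight `x` obeys all the integer bounds that the weight `y` obeys. -/
def RespectsBounds (L : Finset (Finset α)) (y x : α → ℝ) : Prop :=
  ∀ A ∈ L, ∀ z : ℤ, (∑ i ∈ A, y i ≤ z → ∑ i ∈ A, x i ≤ z) ∧
    ((z : ℝ) ≤ ∑ i ∈ A, y i → (z : ℝ) ≤ ∑ i ∈ A, x i)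

lemma RespectsBounds.refl (L : Finset (Finset α)) (y : α → ℝ) : RespectsBounds L y y :=
  fun _ _ _ => ⟨id, id⟩

lemma RespectsBounds.trans {L : Finset (Finset α)} {x y z : α → ℝ}
    (hxy : RespectsBounds L x y) (hyz : RespectsBounds L y z) : RespectsBounds L x z :=
  fun A hA n => ⟨fun h => (hyz A hA n).1 ((hxy A hA n).1 h),
    fun h => (hyz A hA n).2 ((hxy A hA n).2 h)⟩

open Classical in
/-- The sets of `L` whose `y`-weight is not an integer. -/
noncomputable def fractionalSets (L : Finset (Finset α)) (y : α → ℝ) : Finset (Finset α) :=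
  {A ∈ L | ¬ IsIntegerCast (∑ i ∈ A, y i)}

variable [DecidableEq α]

/-- The weight `y` after moving mass `s` from `j` to `i`. -/
def transfer (y : α → ℝ) (i j : α) (s : ℝ) : α → ℝ :=
  fun l => y l + s * ((if l = i then 1 else 0) - (if l = j then 1 else 0))

lemma sum_transfer (y : α → ℝ) (i j : α) (s : ℝ) (B : Finset α) :
    ∑ l ∈ B, transfer y i j s l
      = ∑ l ∈ B, y l + s * ((if i ∈ B then 1 else 0) - (if j ∈ B then 1 else 0)) := by
  simp [transfer, sum_add_distrib, ← mul_sum, sum_sub_distrib]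

/-- If no set of integral weight separates `i` from `j`, mass can be moved from `j` to `i` until
some further set gets integral weight, without violating any integer bound. -/
lemma exists_transfer {L : Finset (Finset α)} {y : α → ℝ} {i j : α} (hij : i ≠ j)
    (hi : {i} ∈ L)
    (hsep : ∀ B ∈ L, IsIntegerCast (∑ l ∈ B, y l) → (i ∈ B ↔ j ∈ B)) :
    ∃ s > 0, RespectsBounds L y (transfer y i j s) ∧
      #(fractionalSets L (transfer y i j s)) < #(fractionalSets L y) := by
  classical
  let slack : Finset α → ℝ := fun B =>
    if i ∈ B then ⌈∑ l ∈ B, y l⌉ - ∑ l ∈ B, y l else ∑ l ∈ B, y l - ⌊∑ l ∈ B, y l⌋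
  obtain ⟨B₀, hB₀, hmin⟩ := exists_min_image {B ∈ L | ¬ (i ∈ B ↔ j ∈ B)} slack
    ⟨{i}, by simp [hi, hij.symm]⟩
  rw [mem_filter] at hB₀
  have hfrac : ¬ IsIntegerCast (∑ l ∈ B₀, y l) := fun h => hB₀.2 (hsep B₀ hB₀.1 h)
  have hpos : 0 < slack B₀ := by
    simp only [slack]
    split_ifs
    · refine sub_pos.2 (lt_of_le_of_ne (Int.le_ceil _) fun h => hfrac ?_)
      rw [h]; exact isIntegerCast_intCast _
    · refine sub_pos.2 (lt_of_le_of_ne (Int.floor_le _) fun h => hfrac ?_)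
      rw [← h]; exact isIntegerCast_intCast _
  have hle : ∀ B ∈ L, ¬ (i ∈ B ↔ j ∈ B) → slack B₀ ≤ slack B :=
    fun B hB h => hmin B (mem_filter.2 ⟨hB, h⟩)
  refine ⟨slack B₀, hpos, fun B hB z => ?_, card_lt_card ?_⟩
  · rw [sum_transfer]
    have h := hle B hB
    by_cases h1 : i ∈ B <;> by_cases h2 : j ∈ B
    · simp [h1, h2]
    · have h3 := h (by simp [h1, h2])
      have h4 : slack B = ⌈∑ l ∈ B, y l⌉ - ∑ l ∈ B, y l := if_pos h1
      simp only [h1, h2, if_true, if_false]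
      refine ⟨fun hz => ?_, fun hz => by linarith⟩
      have : (⌈∑ l ∈ B, y l⌉ : ℝ) ≤ z := by exact_mod_cast Int.ceil_le.2 hz
      linarith
    · have h3 := h (by simp [h1, h2])
      have h4 : slack B = ∑ l ∈ B, y l - ⌊∑ l ∈ B, y l⌋ := if_neg h1
      simp only [h1, h2, if_true, if_false]
      refine ⟨fun hz => by linarith, fun hz => ?_⟩
      have : (z : ℝ) ≤ ⌊∑ l ∈ B, y l⌋ := by exact_mod_cast Int.le_floor.2 hz
      linarith
    · simp [h1, h2]
  · refine (ssubset_iff_of_subset fun B hB => ?_).2 ⟨B₀, ?_, ?_⟩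
    · simp only [fractionalSets, mem_filter] at hB ⊢
      refine ⟨hB.1, fun h => hB.2 ?_⟩
      rw [sum_transfer]
      simpa [hsep B hB.1 h] using h
    · simp [fractionalSets, hB₀.1, hfrac]
    · simp only [fractionalSets, mem_filter, not_and, not_not, sum_transfer]
      intro _
      have h := hB₀.2
      by_cases h1 : i ∈ B₀ <;> by_cases h2 : j ∈ B₀
      · simp [h1, h2] at h
      · convert isIntegerCast_intCast ⌈∑ l ∈ B₀, y l⌉ using 1
        simp [slack, h1, h2]
      · convert isIntegerCast_intCast ⌊∑ l ∈ B₀, y l⌋ using 1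
        simp only [slack, h1, h2, if_true, if_false]
        ring
      · simp [h1, h2] at h

/-- In a laminar family, some pair of fractional elements is not separated by any set of
integral weight. -/
lemma exists_unseparated_pair {F : Finset α} {L : Finset (Finset α)} {y : α → ℝ}
    (hF : F ∈ L) (hFint : IsIntegerCast (∑ l ∈ F, y l))
    (hlam : ∀ A ∈ L, ∀ B ∈ L, A ⊆ B ∨ B ⊆ A ∨ Disjoint A B)
    (hfrac : ∃ i ∈ F, ¬ IsIntegerCast (y i)) :
    ∃ i j, i ≠ j ∧ (∃ A ∈ L, i ∈ A ∧ j ∈ A) ∧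
      ∀ B ∈ L, IsIntegerCast (∑ l ∈ B, y l) → (i ∈ B ↔ j ∈ B) := by
  classical
  obtain ⟨A, hA, hmin⟩ := exists_min_image
    {B ∈ L | IsIntegerCast (∑ l ∈ B, y l) ∧ ∃ i ∈ B, ¬ IsIntegerCast (y i)} card
    ⟨F, by simpa [hF, hFint] using hfrac⟩
  obtain ⟨hAL, hAint, i, hiA, hi⟩ := mem_filter.1 hA
  obtain ⟨j, hjA, hji, hj⟩ : ∃ j ∈ A, j ≠ i ∧ ¬ IsIntegerCast (y j) := by
    by_contra! h
    refine hi ?_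
    have hrest : IsIntegerCast (∑ l ∈ A.erase i, y l) :=
      sum_mem fun l hl => h l (mem_of_mem_erase hl) (ne_of_mem_erase hl)
    rw [← add_sum_erase A y hiA] at hAint
    exact (AddSubgroup.add_mem_cancel_right _ hrest).1 hAint
  have key : ∀ B ∈ L, IsIntegerCast (∑ l ∈ B, y l) → ∀ l ∈ A, ¬ IsIntegerCast (y l) →
      l ∈ B → A ⊆ B := by
    intro B hB hBint l hlA hl hlB
    rcases hlam A hAL B hB with h | h | h
    · exact h
    · exact (eq_of_subset_of_card_le h (hmin B (mem_filter.2 ⟨hB, hBint, l, hlB, hl⟩))).ge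
    · exact absurd hlB (disjoint_left.1 h hlA)
  exact ⟨i, j, hji.symm, ⟨A, hAL, hiA, hjA⟩, fun B hB hBint =>
    ⟨fun h => key B hB hBint i hiA hi h hjA, fun h => key B hB hBint j hjA hj h hiA⟩⟩

/-- A weight of integral total mass is a convex combination of integral weights which respect its
integer bounds on a laminar family. -/
theorem mem_convexHull_respectsBounds {F : Finset α} {L : Finset (Finset α)}
    (hF : F ∈ L) (hLF : ∀ A ∈ L, A ⊆ F) (hsingle : ∀ i ∈ F, {i} ∈ L)
    (hlam : ∀ A ∈ L, ∀ B ∈ L, A ⊆ B ∨ B ⊆ A ∨ Disjoint A B)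
    (y : α → ℝ) (hFint : IsIntegerCast (∑ l ∈ F, y l)) :
    y ∈ convexHull ℝ {x | (∀ i ∈ F, IsIntegerCast (x i)) ∧ RespectsBounds L y x} := by
  induction hn : #(fractionalSets L y) using Nat.strong_induction_on generalizing y with
  | _ n ih =>
  subst hn
  by_cases hint : ∀ i ∈ F, IsIntegerCast (y i)
  · exact subset_convexHull ℝ _ ⟨hint, .refl L y⟩
  obtain ⟨i, j, hij, ⟨A, hA, hiA, hjA⟩, hsep⟩ :=
    exists_unseparated_pair hF hFint hlam (by simpa using hint)
  have hiF := hLF A hA hiA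
  have hjF := hLF A hA hjA
  obtain ⟨s, hs, hsy, hscard⟩ := exists_transfer hij (hsingle i hiF) hsep
  obtain ⟨t, ht, hty, htcard⟩ := exists_transfer hij.symm (hsingle j hjF)
    fun B hB h => (hsep B hB h).symm
  have hmono : ∀ y', RespectsBounds L y y' →
      {x | (∀ i ∈ F, IsIntegerCast (x i)) ∧ RespectsBounds L y' x} ⊆
        {x | (∀ i ∈ F, IsIntegerCast (x i)) ∧ RespectsBounds L y x} :=
    fun y' h x hx => ⟨hx.1, h.trans hx.2⟩
  have hs' := convexHull_mono (hmono _ hsy)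
    (ih _ hscard _ (by simpa [sum_transfer, hiF, hjF] using hFint) rfl)
  have ht' := convexHull_mono (hmono _ hty)
    (ih _ htcard _ (by simpa [sum_transfer, hiF, hjF] using hFint) rfl)
  have hst : s + t ≠ 0 := by positivity
  have hcomb := (convex_convexHull ℝ _) hs' ht'
    (show 0 ≤ t / (s + t) by positivity) (show 0 ≤ s / (s + t) by positivity)
    (by field_simp; ring)
  convert hcomb using 1
  ext l
  simp only [transfer, Pi.add_apply, Pi.smul_apply, smul_eq_mul]
  field_simp
  ring

/-- An integral number in `[0, 1]` is `0` or `1`. -/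
lemma IsIntegerCast.eq_zero_or_one {r : ℝ} (h : IsIntegerCast r) (h0 : 0 ≤ r) (h1 : r ≤ 1) :
    r = 0 ∨ r = 1 := by
  obtain ⟨z, rfl⟩ := h
  simp only [Int.coe_castAddHom] at h0 h1 ⊢
  norm_cast at h0 h1 ⊢
  omega

/-- The family of the ground set, the bundles, the unions of matched bundles and the singletons. -/
def bundleFamily (F : Finset α) {m : ℕ} (U : Fin m → Finset α) (M : Finset (Fin m × Fin m)) :
    Finset (Finset α) :=
  insert F (univ.image U ∪ M.image (fun p => U p.1 ∪ U p.2) ∪ F.image singleton)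

lemma mem_bundleFamily {F : Finset α} {m : ℕ} {U : Fin m → Finset α}
    {M : Finset (Fin m × Fin m)} {A : Finset α} :
    A ∈ bundleFamily F U M ↔
      A = F ∨ (∃ t, U t = A) ∨ (∃ p ∈ M, U p.1 ∪ U p.2 = A) ∨ ∃ i ∈ F, {i} = A := by
  simp only [bundleFamily, mem_insert, mem_union, mem_image, mem_univ, true_and, or_assoc]

lemma subset_of_mem_bundleFamily {F : Finset α} {m : ℕ} {U : Fin m → Finset α}
    {M : Finset (Fin m × Fin m)} (hUsub : ∀ t, U t ⊆ F) {A : Finset α}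
    (hA : A ∈ bundleFamily F U M) : A ⊆ F := by
  rcases mem_bundleFamily.1 hA with rfl | ⟨t, rfl⟩ | ⟨p, -, rfl⟩ | ⟨i, hi, rfl⟩
  · exact Subset.rfl
  · exact hUsub t
  · exact union_subset (hUsub _) (hUsub _)
  · exact singleton_subset_iff.2 hi

lemma bundleFamily_laminar {F : Finset α} {m : ℕ} {U : Fin m → Finset α}
    {M : Finset (Fin m × Fin m)} (hUsub : ∀ t, U t ⊆ F)
    (hUdisj : ∀ t t', t ≠ t' → Disjoint (U t) (U t'))
    (hM : ∀ p ∈ M, ∀ q ∈ M, p ≠ q → ({p.1, p.2} : Finset (Fin m)) ∩ {q.1, q.2} = ∅) :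
    ∀ A ∈ bundleFamily F U M, ∀ B ∈ bundleFamily F U M, A ⊆ B ∨ B ⊆ A ∨ Disjoint A B := by
  have single : ∀ (i : α) (B : Finset α), {i} ⊆ B ∨ Disjoint {i} B := fun i B => by
    by_cases h : i ∈ B <;> simp [h]
  have bundlePair : ∀ (t : Fin m) (p : Fin m × Fin m),
      U t ⊆ U p.1 ∪ U p.2 ∨ Disjoint (U t) (U p.1 ∪ U p.2) := fun t p => by
    by_cases h1 : t = p.1
    · subst h1; exact .inl subset_union_left
    by_cases h2 : t = p.2
    · subst h2; exact .inl subset_union_right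
    exact .inr (disjoint_union_right.2 ⟨hUdisj _ _ h1, hUdisj _ _ h2⟩)
  intro A hA B hB
  have hAF := subset_of_mem_bundleFamily hUsub hA
  have hBF := subset_of_mem_bundleFamily hUsub hB
  rcases mem_bundleFamily.1 hA with rfl | ⟨t, rfl⟩ | ⟨p, hp, rfl⟩ | ⟨i, hi, rfl⟩
  · exact .inr (.inl hBF)
  · rcases mem_bundleFamily.1 hB with rfl | ⟨t', rfl⟩ | ⟨q, hq, rfl⟩ | ⟨j, hj, rfl⟩
    · exact .inl hAF
    · by_cases h : t = t'
      · exact .inl (h ▸ Subset.rfl)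
      · exact .inr (.inr (hUdisj _ _ h))
    · exact (bundlePair t q).imp_right .inr
    · exact .inr ((single j _).imp_right fun h => h.symm)
  · rcases mem_bundleFamily.1 hB with rfl | ⟨t', rfl⟩ | ⟨q, hq, rfl⟩ | ⟨j, hj, rfl⟩
    · exact .inl hAF
    · exact .inr ((bundlePair t' p).imp_right fun h => h.symm)
    · by_cases h : p = q
      · exact .inl (h ▸ Subset.rfl)
      · have h' := disjoint_iff_inter_eq_empty.2 (hM p hp q hq h)
        simp only [disjoint_insert_left, disjoint_singleton_left, mem_insert, mem_singleton,
          not_or] at h'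
        refine .inr (.inr ?_)
        simp only [disjoint_union_left, disjoint_union_right]
        exact ⟨⟨hUdisj _ _ h'.1.1, hUdisj _ _ h'.2.1⟩, hUdisj _ _ h'.1.2, hUdisj _ _ h'.2.2⟩
    · exact .inr ((single j _).imp_right fun h => h.symm)
  · exact (single i B).imp_right .inr

open Classical in
/-- The support in `F` of a `0`-`1` weight. -/
noncomputable def openSet (F : Finset α) (x : α → ℝ) : Finset α := {i ∈ F | x i = 1}

lemma sum_eq_card_openSet_inter {F A : Finset α} {x : α → ℝ}
    (hx : ∀ i ∈ F, x i = 0 ∨ x i = 1) (hA : A ⊆ F) :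
    ∑ i ∈ A, x i = #(openSet F x ∩ A) := by
  classical
  have h : openSet F x ∩ A = {i ∈ A | x i = 1} := by
    ext i
    simp only [openSet, mem_inter, mem_filter]
    exact ⟨fun h => ⟨h.2, h.1.2⟩, fun h => ⟨⟨hA h.1, h.2⟩, h.1⟩⟩
  rw [h, card_filter, Nat.cast_sum]
  refine sum_congr rfl fun i hi => ?_
  rcases hx i (hA hi) with h | h <;> simp [h]

end LaminarRounding

theorem stmt4 {α : Type*} [DecidableEq α] (F : Finset α) (k : ℕ) (hk : 1 ≤ k)
    (y : α → ℝ) (hy : ∀ i ∈ F, 0 ≤ y i ∧ y i ≤ 1)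
    (hysum : ∑ i ∈ F, y i = (k : ℝ))
    -- pairwise disjoint bundles U_1, ..., U_m ⊆ F of volume between 1/2 and 1
    (m : ℕ) (U : Fin m → Finset α)
    (hUsub : ∀ t, U t ⊆ F)
    (hUdisj : ∀ t t', t ≠ t' → Disjoint (U t) (U t'))
    (hUvol : ∀ t, 1 / 2 ≤ ∑ i ∈ U t, y i ∧ ∑ i ∈ U t, y i ≤ 1)
    -- a set M of pairwise disjoint (unordered) pairs of indices
    (M : Finset (Fin m × Fin m))
    (hM1 : ∀ p ∈ M, p.1 ≠ p.2)
    (hM2 : ∀ p ∈ M, ∀ q ∈ M, p ≠ q →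
      ({p.1, p.2} : Finset (Fin m)) ∩ {q.1, q.2} = ∅) :
    ∃ μ : Finset α → ℝ,
      (∀ S, 0 ≤ μ S) ∧
      (∀ S, μ S ≠ 0 → S ⊆ F ∧ S.card ≤ k) ∧
      (∑ S ∈ F.powerset, μ S = 1) ∧
      (∀ i ∈ F, ∑ S ∈ F.powerset, μ S * (if i ∈ S then 1 else 0) = y i) ∧
      (∀ t, ∑ S ∈ F.powerset, μ S * (if (S ∩ U t).Nonempty then 1 else 0)
        = ∑ i ∈ U t, y i) ∧
      (∀ p ∈ M, ∑ S ∈ F.powerset,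
          μ S * (if (S ∩ (U p.1 ∪ U p.2)).Nonempty then 1 else 0) = 1) := by
  classical
  set L := bundleFamily F U M
  have hFL : F ∈ L := mem_bundleFamily.2 (.inl rfl)
  have hUL : ∀ t, U t ∈ L := fun t => mem_bundleFamily.2 (.inr (.inl ⟨t, rfl⟩))
  have hpairL : ∀ p ∈ M, U p.1 ∪ U p.2 ∈ L := fun p hp =>
    mem_bundleFamily.2 (.inr (.inr (.inl ⟨p, hp, rfl⟩)))
  have hsingle : ∀ i ∈ F, {i} ∈ L := fun i hi =>
    mem_bundleFamily.2 (.inr (.inr (.inr ⟨i, hi, rfl⟩)))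
  have hmem := mem_convexHull_respectsBounds hFL (fun A => subset_of_mem_bundleFamily hUsub)
    hsingle (bundleFamily_laminar hUsub hUdisj hM2) y
    (by rw [hysum]; exact_mod_cast isIntegerCast_intCast k)
  obtain ⟨ι, _, w, x, hw0, hw1, hx, hwx⟩ := mem_convexHull_iff_exists_fintype.1 hmem
  have hx01 : ∀ a, ∀ i ∈ F, x a i = 0 ∨ x a i = 1 := fun a i hi => by
    have h0 := ((hx a).2 _ (hsingle i hi) 0).2
    have h1 := ((hx a).2 _ (hsingle i hi) 1).1
    simp only [sum_singleton, Int.cast_zero, Int.cast_one] at h0 h1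
    exact ((hx a).1 i hi).eq_zero_or_one (h0 (hy i hi).1) (h1 (hy i hi).2)
  have hcard : ∀ a, ∀ A ⊆ F, ∑ i ∈ A, x a i = #(openSet F (x a) ∩ A) := fun a A hA =>
    sum_eq_card_openSet_inter (hx01 a) hA
  have hsub : ∀ a, openSet F (x a) ⊆ F := fun a => filter_subset _ _
  have hmean : ∀ A, ∑ a, w a * ∑ i ∈ A, x a i = ∑ i ∈ A, y i := fun A => by
    simp only [← hwx, mul_sum, Finset.sum_apply, Pi.smul_apply, smul_eq_mul]
    exact sum_comm
  have hpush : ∀ g : Finset α → ℝ,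
      ∑ S ∈ F.powerset, (∑ a, if openSet F (x a) = S then w a else 0) * g S
        = ∑ a, w a * g (openSet F (x a)) := fun g => by
    simp only [sum_mul]
    rw [sum_comm]
    refine sum_congr rfl fun a _ => ?_
    simp [ite_mul, hsub a]
  refine ⟨fun S => ∑ a, if openSet F (x a) = S then w a else 0, fun S => ?_, fun S hS => ?_,
    ?_, fun i hi => ?_, fun t => ?_, fun p hp => ?_⟩
  · exact sum_nonneg fun a _ => by split_ifs <;> simp [hw0 a]
  · obtain ⟨a, -, ha⟩ := exists_ne_zero_of_sum_ne_zero hS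
    obtain rfl : openSet F (x a) = S := by by_contra h; simp [h] at ha
    refine ⟨hsub a, ?_⟩
    have h := ((hx a).2 F hFL k).1 (by simp [hysum])
    rw [hcard a F Subset.rfl, inter_eq_left.2 (hsub a)] at h
    exact_mod_cast h
  · simpa [hw1] using hpush fun _ => 1
  · rw [hpush, ← sum_singleton y i, ← hmean]
    refine sum_congr rfl fun a _ => ?_
    rcases hx01 a i hi with h | h <;> simp [openSet, h, hi]
  · rw [hpush, ← hmean]
    refine sum_congr rfl fun a _ => ?_
    have h := ((hx a).2 _ (hUL t) 1).1 (by simpa using (hUvol t).2)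
    rw [hcard a _ (hUsub t)] at h ⊢
    norm_cast at h
    split_ifs with hne
    · rw [le_antisymm h hne.card_pos, Nat.cast_one]
    · simp [not_nonempty_iff_eq_empty.1 hne]
  · rw [hpush]
    refine Eq.trans ?_ hw1
    refine sum_congr rfl fun a _ => ?_
    have hvol : (1 : ℝ) ≤ ∑ i ∈ U p.1 ∪ U p.2, y i := by
      rw [sum_union (hUdisj _ _ (hM1 p hp))]
      linarith [(hUvol p.1).1, (hUvol p.2).1]
    have h := ((hx a).2 _ (hpairL p hp) 1).2 (by simpa using hvol)
    rw [hcard a _ (union_subset (hUsub _) (hUsub _))] at h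
    rw [if_pos (card_pos.1 (by exact_mod_cast h)), mul_one]
end

section
/- Let n ≥ 1, ε > 0, and let w : {1,...,n} → ℝ_{≥0} be non-increasing. Define w* : {1,...,n} → ℝ_{≥0} by w*_1 = w_1; for j ≥ 2, w*_j = (1+ε)^{⌊log_{1+ε}(w_j)⌋} if w_j > ε·w_1/n, and w*_j = 0 if w_j ≤ ε·w_1/n. Then for every non-increasing d : {1,...,n} → ℝ_{≥0}: Σ_{j=1}^n w*_j·d_j ≤ Σ_{j=1}^n w_j·d_j ≤ (1+ε)·Σ_{j=1}^n w*_j·d_j. -/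
open Finset

/-- Rounding a positive real down to an integer power of the base `b > 1` loses at most
a factor `b`. -/
theorem zpow_floor_logb_bounds {b x : ℝ} (hb : 1 < b) (hx : 0 < x) :
    b ^ ⌊Real.logb b x⌋ ≤ x ∧ x ≤ b * b ^ ⌊Real.logb b x⌋ := by
  have hb0 : 0 < b := one_pos.trans hb
  constructor
  · rw [← Real.rpow_intCast, ← Real.le_logb_iff_rpow_le hb hx]
    exact Int.floor_le _
  · rw [← zpow_one_add₀ hb0.ne', ← Real.rpow_intCast, ← Real.logb_le_iff_le_rpow hb hx]
    push_cast
    linarith [Int.lt_floor_add_one (Real.logb b x)]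

theorem stmt10 (n : ℕ) (hn : 1 ≤ n) (ε : ℝ) (hε : 0 < ε)
    -- w : {1,...,n} → ℝ_{≥0} non-increasing
    (w : ℕ → ℝ)
    (hwnn : ∀ j ∈ Finset.Icc 1 n, 0 ≤ w j)
    (hwmono : ∀ j ∈ Finset.Icc 1 n, ∀ j' ∈ Finset.Icc 1 n, j ≤ j' → w j' ≤ w j)
    -- the rounded weight vector w*
    (ws : ℕ → ℝ)
    (hws1 : ws 1 = w 1)
    (hws : ∀ j ∈ Finset.Icc 2 n,
      (ε * w 1 / n < w j → ws j = (1 + ε) ^ ⌊Real.logb (1 + ε) (w j)⌋) ∧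
      (w j ≤ ε * w 1 / n → ws j = 0)) :
    ∀ d : ℕ → ℝ,
      (∀ j ∈ Finset.Icc 1 n, 0 ≤ d j) →
      (∀ j ∈ Finset.Icc 1 n, ∀ j' ∈ Finset.Icc 1 n, j ≤ j' → d j' ≤ d j) →
      ∑ j ∈ Finset.Icc 1 n, ws j * d j ≤ ∑ j ∈ Finset.Icc 1 n, w j * d j ∧
      ∑ j ∈ Finset.Icc 1 n, w j * d j ≤ (1 + ε) * ∑ j ∈ Finset.Icc 1 n, ws j * d j := by
  intro d hd hdmono
  have hmem : 1 ∈ Finset.Icc 1 n := Finset.mem_Icc.2 ⟨le_rfl, hn⟩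
  have hn0 : (0 : ℝ) < n := by exact_mod_cast hn
  have hsub {j : ℕ} (hj : j ∈ Finset.Icc 2 n) : j ∈ Finset.Icc 1 n :=
    Finset.Icc_subset_Icc_left one_le_two hj
  have hw1 := hwnn 1 hmem
  have hd1 := hd 1 hmem
  have hthr : 0 ≤ ε * w 1 / n := by positivity
  have hlower : ∀ j ∈ Finset.Icc 2 n, ws j * d j ≤ w j * d j := fun j hj => by
    refine mul_le_mul_of_nonneg_right ?_ (hd j (hsub hj))
    rcases lt_or_ge (ε * w 1 / n) (w j) with h | h
    · rw [(hws j hj).1 h]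
      exact (zpow_floor_logb_bounds (by linarith) (hthr.trans_lt h)).1
    · rw [(hws j hj).2 h]
      exact hwnn j (hsub hj)
  have hupper : ∀ j ∈ Finset.Icc 2 n,
      w j * d j ≤ (1 + ε) * (ws j * d j) + ε * w 1 / n * d 1 := fun j hj => by
    have hdj := hd j (hsub hj)
    rcases lt_or_ge (ε * w 1 / n) (w j) with h | h
    · rw [(hws j hj).1 h, ← mul_assoc]
      have hround := (zpow_floor_logb_bounds (b := 1 + ε) (by linarith) (hthr.trans_lt h)).2
      exact (mul_le_mul_of_nonneg_right hround hdj).trans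
        (le_add_of_nonneg_right (mul_nonneg hthr hd1))
    · rw [(hws j hj).2 h, zero_mul, mul_zero, zero_add]
      exact mul_le_mul h (hdmono 1 hmem j (hsub hj) (Finset.mem_Icc.1 (hsub hj)).1) hdj hthr
  have hsplit (f : ℕ → ℝ) : ∑ j ∈ Finset.Icc 1 n, f j = f 1 + ∑ j ∈ Finset.Icc 2 n, f j :=
    (Finset.add_sum_Ioc_eq_sum_Icc hn).symm
  rw [hsplit, hsplit, hws1]
  refine ⟨by linarith [Finset.sum_le_sum hlower], ?_⟩
  have hsum := Finset.sum_le_sum hupper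
  rw [Finset.sum_add_distrib, ← Finset.mul_sum, Finset.sum_const, Nat.card_Icc,
    nsmul_eq_mul] at hsum
  have hcard : ((n + 1 - 2 : ℕ) : ℝ) * (ε * w 1 / n * d 1) ≤ ε * (w 1 * d 1) :=
    calc ((n + 1 - 2 : ℕ) : ℝ) * (ε * w 1 / n * d 1) ≤ n * (ε * w 1 / n * d 1) :=
          mul_le_mul_of_nonneg_right (by exact_mod_cast (by omega : n + 1 - 2 ≤ n))
            (mul_nonneg hthr hd1)
      _ = ε * (w 1 * d 1) := by field_simp
  linarith
end

section
/- Let n ≥ 1, let ε > 0 satisfy ε·n ≥ 1, and let w : {1,...,n} → ℝ_{≥0} be non-increasing with w_1 > 0. Define w* : {1,...,n} → ℝ_{≥0} by w*_1 = w_1; for j ≥ 2, w*_j = (1+ε)^{⌊log_{1+ε}(w_j)⌋} if w_j > ε·w_1/n, and w*_j = 0 if w_j ≤ ε·w_1/n. Then the number of distinct values attained by w*, i.e. |{a : ∃ j, w*_j = a}|, is less than 2·log_{1+ε}(n) + 5. -/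
open Finset

theorem stmt11 (n : ℕ) (hn : 1 ≤ n) (ε : ℝ) (hε : 0 < ε) (hεn : 1 ≤ ε * n)
    -- w : {1,...,n} → ℝ_{≥0} non-increasing with w_1 > 0
    (w : ℕ → ℝ) (hw1 : 0 < w 1)
    (hwnn : ∀ j ∈ Finset.Icc 1 n, 0 ≤ w j)
    (hwmono : ∀ j ∈ Finset.Icc 1 n, ∀ j' ∈ Finset.Icc 1 n, j ≤ j' → w j' ≤ w j)
    -- the rounded weight vector w*
    (ws : ℕ → ℝ)
    (hws1 : ws 1 = w 1)
    (hws : ∀ j ∈ Finset.Icc 2 n,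
      (ε * w 1 / n < w j → ws j = (1 + ε) ^ ⌊Real.logb (1 + ε) (w j)⌋) ∧
      (w j ≤ ε * w 1 / n → ws j = 0)) :
    (((Finset.Icc 1 n).image ws).card : ℝ) < 2 * Real.logb (1 + ε) n + 5 := by
  have hb : 1 < 1 + ε := by linarith
  have hn0 : (0 : ℝ) < n := by exact_mod_cast hn
  have hn1 : (1 : ℝ) ≤ n := by exact_mod_cast hn
  have hc : 0 < ε * w 1 / n := by positivity
  set A := Real.logb (1 + ε) (w 1)
  set B := Real.logb (1 + ε) (ε * w 1 / n) with hB
  have hsub : (Finset.Icc 1 n).image ws ⊆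
      insert (w 1) (insert 0 ((Finset.Icc ⌊B⌋ ⌊A⌋).image fun k : ℤ => (1 + ε) ^ k)) := by
    intro a ha
    obtain ⟨j, hj, rfl⟩ := Finset.mem_image.mp ha
    obtain ⟨hj1, hjn⟩ := Finset.mem_Icc.mp hj
    rcases hj1.eq_or_lt with rfl | hj2
    · simp [hws1]
    obtain ⟨hlarge, hsmall⟩ := hws j (Finset.mem_Icc.mpr ⟨hj2, hjn⟩)
    rcases le_or_gt (w j) (ε * w 1 / n) with h | h
    · simp [hsmall h]
    · refine Finset.mem_insert_of_mem (Finset.mem_insert_of_mem (Finset.mem_image.mpr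
        ⟨⌊Real.logb (1 + ε) (w j)⌋, Finset.mem_Icc.mpr ⟨?_, ?_⟩, (hlarge h).symm⟩))
      · exact Int.floor_le_floor (Real.logb_le_logb_of_le hb hc h.le)
      · exact Int.floor_le_floor (Real.logb_le_logb_of_le hb (hc.trans h)
          (hwmono 1 (Finset.mem_Icc.mpr ⟨le_rfl, hn⟩) j hj hj1))
  have hcard : ((Finset.Icc 1 n).image ws).card ≤ (⌊A⌋ + 1 - ⌊B⌋).toNat + 2 := by
    refine (Finset.card_le_card hsub).trans ((Finset.card_insert_le _ _).trans ?_)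
    refine Nat.succ_le_succ ((Finset.card_insert_le _ _).trans (Nat.succ_le_succ ?_))
    exact Finset.card_image_le.trans (Int.card_Icc _ _).le
  have hlogn : 0 ≤ Real.logb (1 + ε) n := Real.logb_nonneg hb hn1
  have hAB : A - B ≤ 2 * Real.logb (1 + ε) n := by
    have hε' : 0 ≤ Real.logb (1 + ε) ε + Real.logb (1 + ε) n := by
      rw [← Real.logb_mul hε.ne' hn0.ne']
      exact Real.logb_nonneg hb hεn
    rw [hB, Real.logb_div (by positivity) hn0.ne', Real.logb_mul hε.ne' hw1.ne']
    linarith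
  have hcard' : (((Finset.Icc 1 n).image ws).card : ℝ) ≤ ((⌊A⌋ + 1 - ⌊B⌋).toNat : ℝ) + 2 := by
    exact_mod_cast hcard
  rcases le_total 0 (⌊A⌋ + 1 - ⌊B⌋) with h | h
  · have hcast : ((⌊A⌋ + 1 - ⌊B⌋).toNat : ℝ) = ⌊A⌋ + 1 - ⌊B⌋ := by
      exact_mod_cast congrArg (Int.cast : ℤ → ℝ) (Int.toNat_of_nonneg h)
    linarith [Int.floor_le A, Int.lt_floor_add_one B]
  · rw [Int.toNat_of_nonpos h, Nat.cast_zero] at hcard'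
    linarith
end

section
/- Let n ≥ 1, ε > 0, a > 0, let w : {1,...,n+1} → ℝ_{≥0} be non-increasing with w_{n+1} = 0, and let d : {1,...,n} → ℝ be non-increasing such that for every ℓ there is a natural number s_ℓ with a·(1+ε)^{-(s_ℓ+1)} < d_ℓ ≤ a·(1+ε)^{-s_ℓ}. Then Σ_{ℓ=1}^n a·(1+ε)^{-(s_ℓ+1)}·w_ℓ ≥ (1/(1+ε))·Σ_{ℓ=1}^n (w_ℓ − w_{ℓ+1})·ℓ·a·(1+ε)^{-s_ℓ}. -/
open Finset

/-- Summation by parts against an antitone sequence `T`: the boundary term at `m` is kept. -/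
theorem sum_sub_mul_mul_add_le_sum_mul (w T : ℕ → ℝ) (m : ℕ)
    (hw : ∀ ℓ ∈ Finset.Icc 1 m, 0 ≤ w ℓ)
    (hT : ∀ ℓ, 1 ≤ ℓ → ℓ + 1 ≤ m → T (ℓ + 1) ≤ T ℓ) :
    ∑ ℓ ∈ Finset.Icc 1 m, (w ℓ - w (ℓ + 1)) * (ℓ : ℝ) * T ℓ + w (m + 1) * m * T m
      ≤ ∑ ℓ ∈ Finset.Icc 1 m, T ℓ * w ℓ := by
  induction m with
  | zero => simp
  | succ m ih =>
    have ih' := ih (fun ℓ hℓ => hw ℓ (Finset.Icc_subset_Icc_right m.le_succ hℓ))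
      (fun ℓ h1 h2 => hT ℓ h1 (by omega))
    rw [Finset.sum_Icc_succ_top (by omega), Finset.sum_Icc_succ_top (by omega)]
    have hwm : 0 ≤ w (m + 1) := hw _ (by simp)
    have hstep : (m : ℝ) * T (m + 1) ≤ m * T m := by
      rcases Nat.eq_zero_or_pos m with rfl | hm
      · simp
      · exact mul_le_mul_of_nonneg_left (hT m hm le_rfl) m.cast_nonneg
    have hprod := mul_le_mul_of_nonneg_left hstep hwm
    push_cast
    linarith

theorem stmt12 (n : ℕ) (hn : 1 ≤ n) (ε a : ℝ) (hε : 0 < ε) (ha : 0 < a)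
    -- w : {1,...,n+1} → ℝ_{≥0} non-increasing with w_{n+1} = 0
    (w : ℕ → ℝ)
    (hwnn : ∀ ℓ ∈ Finset.Icc 1 (n + 1), 0 ≤ w ℓ)
    (hwmono : ∀ ℓ ∈ Finset.Icc 1 n, w (ℓ + 1) ≤ w ℓ)
    (hwlast : w (n + 1) = 0)
    -- d : {1,...,n} → ℝ non-increasing
    (d : ℕ → ℝ)
    (hdmono : ∀ ℓ ∈ Finset.Icc 1 n, ∀ ℓ' ∈ Finset.Icc 1 n, ℓ ≤ ℓ' → d ℓ' ≤ d ℓ)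
    -- for every ℓ there is a natural number s_ℓ with
    -- a·(1+ε)^{-(s_ℓ+1)} < d_ℓ ≤ a·(1+ε)^{-s_ℓ}
    (s : ℕ → ℕ)
    (hs : ∀ ℓ ∈ Finset.Icc 1 n,
      a * (1 + ε) ^ (-((s ℓ : ℤ) + 1)) < d ℓ ∧ d ℓ ≤ a * (1 + ε) ^ (-(s ℓ : ℤ))) :
    (1 / (1 + ε)) *
        ∑ ℓ ∈ Finset.Icc 1 n, (w ℓ - w (ℓ + 1)) * (ℓ : ℝ) * (a * (1 + ε) ^ (-(s ℓ : ℤ)))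
      ≤ ∑ ℓ ∈ Finset.Icc 1 n, a * (1 + ε) ^ (-((s ℓ : ℤ) + 1)) * w ℓ := by
  have h1 : 1 < 1 + ε := by linarith
  have hpos : 0 < 1 + ε := by linarith
  have hT : ∀ ℓ, 1 ≤ ℓ → ℓ + 1 ≤ n →
      a * (1 + ε) ^ (-(s (ℓ + 1) : ℤ)) ≤ a * (1 + ε) ^ (-(s ℓ : ℤ)) := by
    intro ℓ hℓ hℓn
    have hmem : ℓ ∈ Finset.Icc 1 n := Finset.mem_Icc.2 ⟨hℓ, by omega⟩
    have hmem' : ℓ + 1 ∈ Finset.Icc 1 n := Finset.mem_Icc.2 ⟨by omega, hℓn⟩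
    have hlt := ((hs _ hmem').1.trans_le (hdmono _ hmem _ hmem' ℓ.le_succ)).trans_le (hs _ hmem).2
    have hexp := (zpow_lt_zpow_iff_right₀ h1).1 (lt_of_mul_lt_mul_left hlt ha.le)
    exact mul_le_mul_of_nonneg_left (zpow_le_zpow_right₀ h1.le (by omega)) ha.le
  have key := sum_sub_mul_mul_add_le_sum_mul w (fun ℓ => a * (1 + ε) ^ (-(s ℓ : ℤ))) n
    (fun ℓ hℓ => hwnn ℓ (Finset.Icc_subset_Icc_right n.le_succ hℓ)) hT
  rw [hwlast, zero_mul, zero_mul, add_zero] at key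
  refine (mul_le_mul_of_nonneg_left key (by positivity)).trans_eq ?_
  rw [Finset.mul_sum]
  refine Finset.sum_congr rfl fun ℓ _ => ?_
  rw [neg_add, zpow_add₀ hpos.ne', zpow_neg_one]
  ring
end

section
/- Let n ≥ 1 and S ≥ 0 be integers, let w : {1,...,n+1} → ℝ_{≥0} be non-increasing with w_{n+1} = 0, let s : {1,...,n} → {0,...,S} be non-decreasing, and for each class index t ∈ {0,...,S} let J_t = {ℓ : s(ℓ) = t}. Let v_0 > v_1 > ... > v_S ≥ 0 be reals. Then Σ_{t : J_t ≠ ∅} v_t·( w_{min(J_t)}·(min(J_t) − 1) − w_{max(J_t)+1}·max(J_t) ) ≤ 0. -/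
open Finset

/-- One-step Abel summation: for a sequence `v` decreasing up to `S` and nonnegative `A` with
`A 0 = 0`, the partial sums of `v t * (A t - A (t + 1))` are bounded by the boundary term. -/
theorem sum_mul_sub_le_neg_boundary {S : ℕ} {v A : ℕ → ℝ}
    (hv : ∀ t, t < S → v (t + 1) ≤ v t) (hA : ∀ t, 0 ≤ A t) (hA0 : A 0 = 0) :
    ∀ k ≤ S, ∑ t ∈ Finset.range (k + 1), v t * (A t - A (t + 1)) ≤ -(v k * A (k + 1)) := by
  intro k
  induction k with
  | zero => simp [hA0]
  | succ k ih =>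
    intro hk
    rw [Finset.sum_range_succ]
    have h := mul_le_mul_of_nonneg_right (hv k hk) (hA (k + 1))
    linarith [ih (by omega)]

/-- A set that is a lower set of `{1, ..., n}` with top element `m` has cardinality `m`. -/
theorem card_filter_Icc_eq {n m : ℕ} {p : ℕ → Prop} [DecidablePred p] (hm : m ≤ n)
    (hp : ∀ ℓ ∈ Finset.Icc 1 n, p ℓ ↔ ℓ ≤ m) : ((Finset.Icc 1 n).filter p).card = m := by
  have : (Finset.Icc 1 n).filter p = Finset.Icc 1 m := by
    ext ℓ
    have := hp ℓ
    grind
  simp [this]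

theorem stmt13 (n S : ℕ) (hn : 1 ≤ n)
    -- w : {1,...,n+1} → ℝ_{≥0} non-increasing with w_{n+1} = 0
    (w : ℕ → ℝ)
    (hwnn : ∀ ℓ ∈ Finset.Icc 1 (n + 1), 0 ≤ w ℓ)
    (hwmono : ∀ ℓ ∈ Finset.Icc 1 n, w (ℓ + 1) ≤ w ℓ)
    (hwlast : w (n + 1) = 0)
    -- s : {1,...,n} → {0,...,S} non-decreasing
    (s : ℕ → ℕ)
    (hsle : ∀ ℓ ∈ Finset.Icc 1 n, s ℓ ≤ S)
    (hsmono : ∀ ℓ ∈ Finset.Icc 1 n, ∀ ℓ' ∈ Finset.Icc 1 n, ℓ ≤ ℓ' → s ℓ ≤ s ℓ')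
    -- the blocks J_t = {ℓ : s(ℓ) = t}
    (J : ℕ → Finset ℕ)
    (hJ : ∀ t, J t = (Finset.Icc 1 n).filter (fun ℓ => s ℓ = t))
    -- v_0 > v_1 > ... > v_S ≥ 0
    (v : ℕ → ℝ)
    (hvmono : ∀ t, t < S → v (t + 1) < v t)
    (hvS : 0 ≤ v S) :
    ∑ t ∈ Finset.range (S + 1),
      (if h : (J t).Nonempty then
        v t * (w ((J t).min' h) * (((J t).min' h : ℝ) - 1)
          - w ((J t).max' h + 1) * ((J t).max' h : ℝ))
      else 0) ≤ 0 := by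
  let c : ℕ → ℕ := fun t => ((Finset.Icc 1 n).filter (fun ℓ => s ℓ < t)).card
  have hc (t : ℕ) : c t ≤ n := by
    simpa using Finset.card_filter_le (Finset.Icc 1 n) (fun ℓ => s ℓ < t)
  let A : ℕ → ℝ := fun t => w (c t + 1) * c t
  have hA (t : ℕ) : 0 ≤ A t :=
    mul_nonneg (hwnn _ (Finset.mem_Icc.2 ⟨by omega, by have := hc t; omega⟩)) (Nat.cast_nonneg _)
  have hA0 : A 0 = 0 := by simp [A, c]
  have hAS : A (S + 1) = 0 := by
    have : c (S + 1) = n := card_filter_Icc_eq le_rfl fun ℓ hℓ => by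
      have := hsle ℓ hℓ
      grind
    simp [A, this, hwlast]
  have key : ∀ t, (if h : (J t).Nonempty then
        v t * (w ((J t).min' h) * (((J t).min' h : ℝ) - 1)
          - w ((J t).max' h + 1) * ((J t).max' h : ℝ))
      else 0) = v t * (A t - A (t + 1)) := by
    intro t
    have hmem (ℓ : ℕ) : ℓ ∈ J t ↔ ℓ ∈ Finset.Icc 1 n ∧ s ℓ = t := by simp [hJ]
    split_ifs with h
    · have hmin := (hmem _).1 ((J t).min'_mem h)
      have hmax := (hmem _).1 ((J t).max'_mem h)
      have hle (ℓ : ℕ) (hℓ : ℓ ∈ J t) : (J t).min' h ≤ ℓ := (J t).min'_le ℓ hℓ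
      have hge (ℓ : ℕ) (hℓ : ℓ ∈ J t) : ℓ ≤ (J t).max' h := (J t).le_max' ℓ hℓ
      generalize (J t).min' h = a at *
      generalize (J t).max' h = b at *
      obtain ⟨ha, hsa⟩ := hmin
      obtain ⟨hb, hsb⟩ := hmax
      have ha' := Finset.mem_Icc.1 ha
      have hca : c t = a - 1 := card_filter_Icc_eq (by omega) fun ℓ hℓ => by
        have h1 := hsmono ℓ hℓ a ha
        have h2 := hsmono a ha ℓ hℓ
        have h3 := hle ℓ
        rw [hmem] at h3
        grind
      have hcb : c (t + 1) = b := card_filter_Icc_eq (Finset.mem_Icc.1 hb).2 fun ℓ hℓ => by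
        have h1 := hsmono ℓ hℓ b hb
        have h2 := hsmono b hb ℓ hℓ
        have h3 := hge ℓ
        rw [hmem] at h3
        grind
      simp only [A, hca, hcb, Nat.sub_add_cancel ha'.1, Nat.cast_sub ha'.1, Nat.cast_one]
    · have : c (t + 1) = c t := by
        refine congrArg Finset.card (Finset.filter_congr fun ℓ hℓ => ?_)
        have : s ℓ ≠ t := fun e => h ⟨ℓ, (hmem ℓ).2 ⟨hℓ, e⟩⟩
        omega
      simp [A, this]
  simp only [key]
  simpa [hAS] using sum_mul_sub_le_neg_boundary (fun t ht => (hvmono t ht).le) hA hA0 S le_rfl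
end

section
/- Let F and C be finite sets, c : F×C → ℝ_{≥0} any cost function, and y : F → [0,1] with Σ_{i∈F} y_i ≥ 1. Call x : F×C → ℝ feasible if 0 ≤ x_{ij} ≤ y_i for all i,j and Σ_{i∈F} x_{ij} = 1 for all j ∈ C. Call a function c' : F×C → ℝ_{≥0} a reduced cost function (for c) if c'(i,j) ≤ c(i,j) for all i,j and c(i,j) ≤ c(i',j') implies c'(i,j) ≤ c'(i',j'). Then there exists a feasible x such that for every reduced cost function c' and every feasible x': Σ_{i∈F,j∈C} c'(i,j)·x_{ij} ≤ Σ_{i∈F,j∈C} c'(i,j)·x'_{ij}. In particular (taking c' = c), x is distance-optimal, and the same x is simultaneously optimal for all reduced cost functions. -/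
open Finset

/-- Greedy filling: a demand `t` can be served from `s` within the capacities `y` so that, for some
threshold element `m`, everything cheaper than `m` is saturated and everything more expensive is
unused. -/
theorem exists_greedy_filling {α : Type*} (s : Finset α) (d y : α → ℝ) (t : ℝ) (ht : 0 < t)
    (hy : ∀ i ∈ s, 0 ≤ y i) (hts : t ≤ ∑ i ∈ s, y i) :
    ∃ x : α → ℝ, (∀ i ∈ s, 0 ≤ x i ∧ x i ≤ y i) ∧ ∑ i ∈ s, x i = t ∧
      ∃ m ∈ s, ∀ i ∈ s, (d i < d m → x i = y i) ∧ (d m < d i → x i = 0) := by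
  classical
  induction s using Finset.induction_on_max_value d with
  | empty => simp at hts; linarith
  | insert a s ha hmax ih =>
    have hne : ∀ i ∈ s, i ≠ a := fun i hi h => ha (h ▸ hi)
    have hys : ∀ i ∈ s, 0 ≤ y i := fun i hi => hy i (mem_insert_of_mem hi)
    have hya : 0 ≤ y a := hy a (mem_insert_self a s)
    rw [sum_insert ha] at hts
    rcases le_or_gt t (∑ i ∈ s, y i) with h | h
    · obtain ⟨x, hx, hsum, m, hm, hxm⟩ := ih hys h
      refine ⟨Function.update x a 0, ?_, ?_, m, mem_insert_of_mem hm, ?_⟩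
      · rw [forall_mem_insert]
        refine ⟨by simpa using hya, fun i hi => ?_⟩
        simpa [hne i hi] using hx i hi
      · rw [sum_insert ha, sum_update_of_notMem ha]
        simpa using hsum
      · rw [forall_mem_insert]
        refine ⟨⟨fun h => absurd h (hmax m hm).not_gt, by simp⟩, fun i hi => ?_⟩
        simpa [hne i hi] using hxm i hi
    · refine ⟨Function.update y a (t - ∑ i ∈ s, y i), ?_, ?_, a, mem_insert_self a s, ?_⟩
      · rw [forall_mem_insert]
        refine ⟨by simp only [Function.update_self]; constructor <;> linarith, fun i hi => ?_⟩
        simpa [hne i hi] using hys i hi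
      · rw [sum_insert ha, sum_update_of_notMem ha]
        simp
      · rw [forall_mem_insert]
        refine ⟨by simp, fun i hi => ⟨by simp [hne i hi], fun h => absurd h (hmax i hi).not_gt⟩⟩

/-- A greedy filling for `d` minimizes every cost `d'` that is monotone in `d`. -/
theorem sum_mul_le_of_greedy_filling {α : Type*} {s : Finset α} {d d' y x x' : α → ℝ} {m : α}
    (hm : m ∈ s) (hxm : ∀ i ∈ s, (d i < d m → x i = y i) ∧ (d m < d i → x i = 0))
    (hd : ∀ i ∈ s, ∀ j ∈ s, d i ≤ d j → d' i ≤ d' j)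
    (hx' : ∀ i ∈ s, 0 ≤ x' i ∧ x' i ≤ y i) (hsum : ∑ i ∈ s, x i = ∑ i ∈ s, x' i) :
    ∑ i ∈ s, d' i * x i ≤ ∑ i ∈ s, d' i * x' i := by
  have key : ∑ i ∈ s, (d' i - d' m) * x i ≤ ∑ i ∈ s, (d' i - d' m) * x' i := by
    refine sum_le_sum fun i hi => ?_
    rcases lt_trichotomy (d i) (d m) with h | h | h
    · rw [(hxm i hi).1 h]
      exact mul_le_mul_of_nonpos_left (hx' i hi).2 (sub_nonpos.2 (hd i hi m hm h.le))
    · simp [le_antisymm (hd i hi m hm h.le) (hd m hm i hi h.ge)]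
    · rw [(hxm i hi).2 h, mul_zero]
      exact mul_nonneg (sub_nonneg.2 (hd m hm i hi h.le)) (hx' i hi).1
  simp only [sub_mul, sum_sub_distrib, ← mul_sum, hsum] at key
  linarith

theorem stmt14 {α : Type*} (F C : Finset α) (c : α → α → ℝ)
    (hc : ∀ i ∈ F, ∀ j ∈ C, 0 ≤ c i j)
    (y : α → ℝ) (hy : ∀ i ∈ F, 0 ≤ y i ∧ y i ≤ 1)
    (hysum : 1 ≤ ∑ i ∈ F, y i) :
    ∃ x : α → α → ℝ,
      -- x is feasible
      ((∀ i ∈ F, ∀ j ∈ C, 0 ≤ x i j ∧ x i j ≤ y i) ∧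
        (∀ j ∈ C, ∑ i ∈ F, x i j = 1)) ∧
      -- x is simultaneously optimal for every reduced cost function c'
      ∀ c' : α → α → ℝ,
        (∀ i ∈ F, ∀ j ∈ C, 0 ≤ c' i j ∧ c' i j ≤ c i j) →
        (∀ i ∈ F, ∀ j ∈ C, ∀ i' ∈ F, ∀ j' ∈ C, c i j ≤ c i' j' → c' i j ≤ c' i' j') →
        ∀ x' : α → α → ℝ,
          (∀ i ∈ F, ∀ j ∈ C, 0 ≤ x' i j ∧ x' i j ≤ y i) →
          (∀ j ∈ C, ∑ i ∈ F, x' i j = 1) →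
          ∑ i ∈ F, ∑ j ∈ C, c' i j * x i j ≤ ∑ i ∈ F, ∑ j ∈ C, c' i j * x' i j := by
  choose x hx hsum m hm hxm using fun j : α =>
    exists_greedy_filling F (fun i => c i j) y 1 one_pos (fun i hi => (hy i hi).1) hysum
  refine ⟨fun i j => x j i, ⟨fun i hi j _ => hx j i hi, fun j _ => hsum j⟩, ?_⟩
  intro c' _ hmono x' hx' hsum'
  rw [sum_comm, sum_comm (s := F)]
  exact sum_le_sum fun j hj => sum_mul_le_of_greedy_filling (hm j) (hxm j)
    (fun i hi i' hi' => hmono i hi j hj i' hi' j hj) (fun i hi => hx' i hi j hj)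
    ((hsum j).trans (hsum' j hj).symm)
end

section
/- Let F (facilities) and C (clients) be finite subsets of a metric space with distance c, and let (x,y) be a normalized, distance-optimal fractional solution to the k-median LP. Let j, j' ∈ C, let T ≥ 0, and let α, β be reals with 1 ≤ α and α ≤ β − 1. Suppose c(j,j') ≤ α·T. Then Σ_{i∈F : c(i,j') ≥ β·T} x_{ij'}·c(i,j') ≤ (β/(β−α))·Σ_{i∈F} x_{ij}·c^T(i,j) = (β/(β−α))·c_av^T(j). -/
open Finset

/-- Truncated cost: `dist i j` if `dist i j ≥ T`, and `0` otherwise. -/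
noncomputable def truncCost {X : Type*} [MetricSpace X] (T : ℝ) (i j : X) : ℝ :=
  if T ≤ dist i j then dist i j else 0

/-- In a distance-optimal solution, a client that uses a facility `a` has saturated every facility
strictly closer than `a`. -/
theorem dist_le_of_distance_optimal {X : Type*} [MetricSpace X] {F C : Finset X}
    {x : X → X → ℝ} {y : X → ℝ}
    (hx : ∀ i ∈ F, ∀ j ∈ C, 0 ≤ x i j ∧ x i j ≤ y i)
    (hxsum : ∀ j ∈ C, ∑ i ∈ F, x i j = 1)
    (hdopt : ∀ x' : X → X → ℝ,
      (∀ i ∈ F, ∀ j ∈ C, 0 ≤ x' i j ∧ x' i j ≤ y i) →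
      (∀ j ∈ C, ∑ i ∈ F, x' i j = 1) →
      ∑ i ∈ F, ∑ j ∈ C, dist i j * x i j ≤ ∑ i ∈ F, ∑ j ∈ C, dist i j * x' i j)
    {j a b : X} (hj : j ∈ C) (ha : a ∈ F) (hb : b ∈ F) (hxa : 0 < x a j) (hxb : x b j < y b) :
    dist a j ≤ dist b j := by
  classical
  by_contra! hlt
  have hab : a ≠ b := by rintro rfl; exact lt_irrefl _ hlt
  obtain ⟨ε, hε, hεa, hεb⟩ : ∃ ε > 0, ε ≤ x a j ∧ ε ≤ y b - x b j :=
    ⟨min (x a j) (y b - x b j), lt_min hxa (sub_pos.2 hxb), min_le_left _ _, min_le_right _ _⟩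
  have key := hdopt
    (fun i l => x i l + if l = j then (if i = b then ε else 0) - (if i = a then ε else 0) else 0)
    (by
      intro i hi l hl
      have h := hx i hi l hl
      split_ifs <;> subst_vars <;> first | exact absurd rfl hab | (constructor <;> linarith))
    (by
      intro l hl
      rw [sum_add_distrib, hxsum l hl]
      by_cases h : l = j <;> simp [h, ha, hb])
  simp only [mul_add, sum_add_distrib, mul_ite, mul_zero, sum_ite_eq', hj, if_true, mul_sub,
    sum_sub_distrib, ha, hb] at key
  nlinarith

/-- The optimal assignment `x · j'` pays no more to facilities far from `j'` than the assignment
`x · j` of another client would. -/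
theorem sum_far_le_of_distance_optimal {X : Type*} [MetricSpace X] {F C : Finset X}
    {x : X → X → ℝ} {y : X → ℝ}
    (hx : ∀ i ∈ F, ∀ j ∈ C, 0 ≤ x i j ∧ x i j ≤ y i)
    (hxsum : ∀ j ∈ C, ∑ i ∈ F, x i j = 1)
    (hdopt : ∀ x' : X → X → ℝ,
      (∀ i ∈ F, ∀ j ∈ C, 0 ≤ x' i j ∧ x' i j ≤ y i) →
      (∀ j ∈ C, ∑ i ∈ F, x' i j = 1) →
      ∑ i ∈ F, ∑ j ∈ C, dist i j * x i j ≤ ∑ i ∈ F, ∑ j ∈ C, dist i j * x' i j)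
    {j j' : X} (hj : j ∈ C) (hj' : j' ∈ C) (R : ℝ) :
    ∑ i ∈ F, (if R ≤ dist i j' then x i j' * dist i j' else 0) ≤
      ∑ i ∈ F, (if R ≤ dist i j' then x i j * dist i j' else 0) := by
  by_cases hfar : ∃ i ∈ F, 0 < x i j' ∧ R ≤ dist i j'
  · obtain ⟨i₀, hi₀, hpos₀, hR₀⟩ := hfar
    obtain ⟨m, hm, hmax⟩ := exists_max_image (F.filter fun i => 0 < x i j')
      (fun i => dist i j') ⟨i₀, mem_filter.2 ⟨hi₀, hpos₀⟩⟩
    obtain ⟨hmF, hmpos⟩ := mem_filter.1 hm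
    have hRm : R ≤ dist m j' := hR₀.trans (hmax i₀ (mem_filter.2 ⟨hi₀, hpos₀⟩))
    have hsum : ∑ i ∈ F, dist m j' * (x i j' - x i j) = 0 := by
      rw [← mul_sum, sum_sub_distrib, hxsum j hj, hxsum j' hj', sub_self, mul_zero]
    rw [← sub_nonpos, ← sum_sub_distrib]
    refine le_of_le_of_eq ?_ hsum
    refine sum_le_sum fun i hi => ?_
    have hnear : dist i j' < dist m j' → 0 ≤ x i j' - x i j := fun h => by
      by_contra! hc
      exact h.not_ge (dist_le_of_distance_optimal hx hxsum hdopt hj' hmF hi hmpos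
        (by linarith [(hx i hi j hj).2]))
    have hbeyond : dist m j' < dist i j' → x i j' - x i j ≤ 0 := fun h => by
      by_contra! hc
      exact h.not_ge (hmax i (mem_filter.2 ⟨hi, by linarith [(hx i hi j hj).1]⟩))
    split_ifs with h
    · rcases lt_trichotomy (dist i j') (dist m j') with h' | h' | h'
      · nlinarith [hnear h']
      · rw [h']; linarith
      · nlinarith [hbeyond h']
    · rw [sub_zero]
      exact mul_nonneg dist_nonneg (hnear ((not_le.1 h).trans_le hRm))
  · push Not at hfar
    refine sum_le_sum fun i hi => ?_
    split_ifs with h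
    · refine mul_le_mul_of_nonneg_right ?_ dist_nonneg
      by_contra! hc
      exact (hfar i hi ((hx i hi j hj).1.trans_lt hc)).not_ge h
    · exact le_rfl

theorem stmt15 {X : Type*} [MetricSpace X] (F C : Finset X) (k : ℕ)
    (x : X → X → ℝ) (y : X → ℝ)
    -- (x, y) is a feasible fractional solution of the k-median LP
    (hy : ∀ i ∈ F, 0 ≤ y i ∧ y i ≤ 1)
    (hx : ∀ i ∈ F, ∀ j ∈ C, 0 ≤ x i j ∧ x i j ≤ y i)
    (hxsum : ∀ j ∈ C, ∑ i ∈ F, x i j = 1)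
    (hysum : ∑ i ∈ F, y i = (k : ℝ))
    -- normalized
    (hnorm : ∀ i ∈ F, ∀ j ∈ C, x i j = 0 ∨ x i j = y i)
    -- distance-optimal
    (hdopt : ∀ x' : X → X → ℝ,
      (∀ i ∈ F, ∀ j ∈ C, 0 ≤ x' i j ∧ x' i j ≤ y i) →
      (∀ j ∈ C, ∑ i ∈ F, x' i j = 1) →
      ∑ i ∈ F, ∑ j ∈ C, dist i j * x i j ≤ ∑ i ∈ F, ∑ j ∈ C, dist i j * x' i j)
    (j j' : X) (hj : j ∈ C) (hj' : j' ∈ C)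
    (T α β : ℝ) (hT : 0 ≤ T) (hα : 1 ≤ α) (hαβ : α ≤ β - 1)
    (hjj' : dist j j' ≤ α * T) :
    ∑ i ∈ F, (if β * T ≤ dist i j' then x i j' * dist i j' else 0) ≤
      (β / (β - α)) * ∑ i ∈ F, x i j * truncCost T i j := by
  refine (sum_far_le_of_distance_optimal hx hxsum hdopt hj hj' (β * T)).trans ?_
  rw [mul_sum]
  refine sum_le_sum fun i hi => ?_
  have hxij := (hx i hi j hj).1
  have hβα : 0 < β - α := by linarith
  have hβ : 0 ≤ β := by linarith
  rw [mul_left_comm]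
  split_ifs with h
  · refine mul_le_mul_of_nonneg_left ?_ hxij
    have htri := dist_triangle i j j'
    have hTij : T ≤ dist i j := by nlinarith
    rw [truncCost, if_pos hTij, div_mul_eq_mul_div, le_div_iff₀ hβα]
    nlinarith
  · refine mul_nonneg hxij (mul_nonneg (div_nonneg hβ hβα.le) ?_)
    unfold truncCost
    split_ifs
    exacts [dist_nonneg, le_rfl]
end
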